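/- arXiv:2405.10002 — 6 statements merged into one kernel-verified Lean document; each statement's English description precedes it below -/
import Mathlib

section
/- For every T₀ > 0 there exists a constant C > 0 such that for every T ∈ (0, T₀] and every ξ ∈ ℝ one has ∑_{k=1}^∞ | e^{−i(λ_k + ξ)T} − 1 | / | λ_k + ξ | ≤ C, where any term with λ_k + ξ = 0 is interpreted as T. Moreover C can be chosen so that C → 0 as T₀ → 0⁺. -/
open Real MeasureTheory Filter

/-- Dirichlet eigenvalues of `-d²/dx²` on `(0,1)`: `λ_k = π² k²`. -/
noncomputable def lam (k : ℕ) : ℝ := Real.pi ^ 2 * (k : ℝ) ^ 2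

/-- `|ρ̂_k(ξ)| = |e^{−i(λ_k+ξ)T} − 1| / |λ_k + ξ|`, the modulus of the Fourier transform at `ξ`
of the truncated exponential `e^{−iλ_k t} 1_{[0,T]}(t)`, with the degenerate case
`λ_k + ξ = 0` interpreted as `T`. -/
noncomputable def rhoHat (k : ℕ) (ξ T : ℝ) : ℝ :=
  if lam k + ξ = 0 then T
  else ‖Complex.exp (-Complex.I * ((lam k + ξ : ℝ) : ℂ) * (T : ℂ)) - 1‖ / |lam k + ξ|

lemma norm_exp_neg_I_mul_sub_one_le (x T : ℝ) :
    ‖Complex.exp (-Complex.I * (x : ℂ) * (T : ℂ)) - 1‖ ≤ |x * T| := by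
  have h := Real.norm_exp_I_mul_ofReal_sub_one_le (x := -(x * T))
  rw [norm_neg, Real.norm_eq_abs] at h
  convert h using 4
  push_cast
  ring

lemma norm_exp_neg_I_mul_sub_one_le_two (x T : ℝ) :
    ‖Complex.exp (-Complex.I * (x : ℂ) * (T : ℂ)) - 1‖ ≤ 2 := by
  have h : ‖Complex.exp (-Complex.I * (x : ℂ) * (T : ℂ))‖ = 1 := by
    have h' := Complex.norm_exp_ofReal_mul_I (-(x * T))
    convert h' using 3
    push_cast
    ring
  calc _ ≤ ‖Complex.exp (-Complex.I * (x : ℂ) * (T : ℂ))‖ + ‖(1 : ℂ)‖ := norm_sub_le _ _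
    _ = 2 := by rw [h, norm_one]; norm_num

lemma rhoHat_nonneg (k : ℕ) (ξ : ℝ) {T : ℝ} (hT : 0 ≤ T) : 0 ≤ rhoHat k ξ T := by
  unfold rhoHat
  split_ifs
  · exact hT
  · positivity

lemma rhoHat_le (k : ℕ) (ξ : ℝ) {T : ℝ} (hT : 0 ≤ T) : rhoHat k ξ T ≤ T := by
  unfold rhoHat
  split_ifs with h
  · exact le_rfl
  · rw [div_le_iff₀ (abs_pos.mpr h)]
    refine (norm_exp_neg_I_mul_sub_one_le _ _).trans_eq ?_
    rw [abs_mul, abs_of_nonneg hT, mul_comm]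

lemma rhoHat_mul_abs_le_two (k : ℕ) (ξ T : ℝ) : rhoHat k ξ T * |lam k + ξ| ≤ 2 := by
  unfold rhoHat
  split_ifs with h
  · simp [h]
  · rw [div_mul_cancel₀ _ (abs_pos.mpr h).ne']
    exact norm_exp_neg_I_mul_sub_one_le_two _ _

/-- The spectral gap: the distance from `-ξ` to `λ_k` grows quadratically in the distance from
`k` to a suitable integer depending only on `ξ`. -/
lemma exists_int_two_mul_sq_le_abs_lam_add (ξ : ℝ) :
    ∃ n : ℤ, ∀ k : ℕ, 2 * (((k : ℤ) - n : ℤ) : ℝ) ^ 2 ≤ |lam k + ξ| := by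
  have hpi : 9 ≤ π ^ 2 := by nlinarith [Real.pi_gt_three]
  rcases le_total 0 ξ with hξ | hξ
  · refine ⟨0, fun k => ?_⟩
    refine le_trans ?_ (le_abs_self _)
    unfold lam
    push_cast
    nlinarith [sq_nonneg (k : ℝ)]
  · obtain ⟨a, ha, rfl⟩ : ∃ a : ℝ, 0 ≤ a ∧ -(π ^ 2 * a ^ 2) = ξ := by
      refine ⟨√(-ξ) / π, by positivity, ?_⟩
      rw [div_pow, Real.sq_sqrt (by linarith)]
      field_simp
    refine ⟨round a, fun k => ?_⟩
    have hk : (0 : ℝ) ≤ k := k.cast_nonneg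
    have hround := abs_sub_round a
    have hdist : |(((k : ℤ) - round a : ℤ) : ℝ)| ≤ 2 * |(k : ℝ) - a| := by
      rcases eq_or_ne ((k : ℤ) - round a) 0 with h | h
      · simp [h]
      · have h1 : (1 : ℝ) ≤ |(((k : ℤ) - round a : ℤ) : ℝ)| := by
          exact_mod_cast Int.one_le_abs h
        have h2 : |(((k : ℤ) - round a : ℤ) : ℝ)| ≤ |(k : ℝ) - a| + |a - round a| := by
          push_cast
          exact abs_sub_le _ _ _
        linarith
    have hsq : (((k : ℤ) - round a : ℤ) : ℝ) ^ 2 ≤ 4 * |(k : ℝ) - a| ^ 2 := by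
      rw [← sq_abs]
      nlinarith [abs_nonneg (((k : ℤ) - round a : ℤ) : ℝ)]
    have hsum : |(k : ℝ) - a| ≤ k + a := abs_le.mpr ⟨by linarith, by linarith⟩
    have hfactor : |lam k + -(π ^ 2 * a ^ 2)| = π ^ 2 * (|(k : ℝ) - a| * (k + a)) := by
      rw [show lam k + -(π ^ 2 * a ^ 2) = π ^ 2 * (((k : ℝ) - a) * (k + a)) by unfold lam; ring,
        abs_mul, abs_mul, abs_of_nonneg (sq_nonneg π), abs_of_nonneg (add_nonneg hk ha)]
    have hprod : |(k : ℝ) - a| ^ 2 ≤ |(k : ℝ) - a| * (k + a) := by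
      rw [sq]
      gcongr
    rw [hfactor]
    nlinarith [sq_nonneg |(k : ℝ) - a|]

/-- A summable majorant of `min T (1 / m²)`. -/
noncomputable def gapMajorant (T : ℝ) (m : ℤ) : ℝ := 2 * T / (1 + T * (m : ℝ) ^ 2)

lemma gapMajorant_nonneg {T : ℝ} (hT : 0 ≤ T) (m : ℤ) : 0 ≤ gapMajorant T m := by
  unfold gapMajorant
  positivity

lemma gapMajorant_mono {S T : ℝ} (hS : 0 ≤ S) (hST : S ≤ T) (m : ℤ) :
    gapMajorant S m ≤ gapMajorant T m := by
  have hT := hS.trans hST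
  unfold gapMajorant
  rw [div_le_div_iff₀ (by positivity) (by positivity)]
  nlinarith

lemma le_gapMajorant {x T : ℝ} {m : ℤ} (hT : 0 ≤ T) (hx : x ≤ T) (hxm : x * (m : ℝ) ^ 2 ≤ 1) :
    x ≤ gapMajorant T m := by
  unfold gapMajorant
  rw [le_div_iff₀ (by positivity)]
  nlinarith

lemma summable_gapMajorant {T : ℝ} (hT : 0 ≤ T) : Summable (gapMajorant T) := by
  refine Summable.of_norm_bounded_eventually
    ((Real.summable_one_div_int_pow.mpr one_lt_two).mul_left 2) ?_
  filter_upwards [(Set.finite_singleton (0 : ℤ)).compl_mem_cofinite] with m hm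
  have hm0 : (m : ℝ) ≠ 0 := by exact_mod_cast hm
  have hm2 : 0 < (m : ℝ) ^ 2 := by positivity
  rw [Real.norm_of_nonneg (gapMajorant_nonneg hT m), gapMajorant, mul_one_div,
    div_le_div_iff₀ (by positivity) hm2]
  linarith

lemma tendsto_tsum_gapMajorant :
    Tendsto (fun T => ∑' m, gapMajorant T m) (nhdsWithin 0 (Set.Ioi 0)) (nhds 0) := by
  have h : Tendsto (fun T => ∑' m, gapMajorant T m) (nhdsWithin 0 (Set.Ioi 0))
      (nhds (∑' _ : ℤ, (0 : ℝ))) := by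
    refine tendsto_tsum_of_dominated_convergence (summable_gapMajorant zero_le_one)
      (fun m => ?_) ?_
    · have hc : ContinuousAt (fun T : ℝ => gapMajorant T m) 0 := by
        unfold gapMajorant
        exact ContinuousAt.div (by fun_prop) (by fun_prop) (by simp)
      have h0 : gapMajorant 0 m = 0 := by simp [gapMajorant]
      simpa [h0] using hc.tendsto.mono_left nhdsWithin_le_nhds
    · filter_upwards [Ioc_mem_nhdsGT (zero_lt_one (α := ℝ))] with T hT m
      rw [Real.norm_of_nonneg (gapMajorant_nonneg hT.1.le m)]
      exact gapMajorant_mono hT.1.le hT.2 m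
  simpa using h

/-- For every `T₀ > 0` there is `C > 0` such that for every `T ∈ (0, T₀]` and every `ξ ∈ ℝ`,
`∑_{k ≥ 1} |e^{−i(λ_k+ξ)T} − 1| / |λ_k + ξ| ≤ C` (the series being convergent); moreover the
constant `C = C(T₀)` can be chosen so that `C(T₀) → 0` as `T₀ → 0⁺`. -/
theorem stmt4 :
    ∃ C : ℝ → ℝ,
      (∀ T₀ : ℝ, 0 < T₀ → 0 < C T₀) ∧
      Tendsto C (nhdsWithin 0 (Set.Ioi 0)) (nhds 0) ∧
      ∀ T₀ : ℝ, 0 < T₀ → ∀ T ∈ Set.Ioc (0:ℝ) T₀, ∀ ξ : ℝ,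
        (Summable fun k : ℕ => rhoHat (k + 1) ξ T) ∧
        (∑' k : ℕ, rhoHat (k + 1) ξ T) ≤ C T₀ := by
  refine ⟨fun T => ∑' m, gapMajorant T m, fun T₀ hT₀ => ?_, tendsto_tsum_gapMajorant,
    fun T₀ hT₀ T hT ξ => ?_⟩
  · exact (summable_gapMajorant hT₀.le).tsum_pos (gapMajorant_nonneg hT₀.le) 0
      (by simpa [gapMajorant] using hT₀)
  obtain ⟨n, hn⟩ := exists_int_two_mul_sq_le_abs_lam_add ξ
  let e : ℕ → ℤ := fun k => ((k + 1 : ℕ) : ℤ) - n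
  have he : Function.Injective e := fun a b hab => by
    simp only [e] at hab
    omega
  have hbound : ∀ k, rhoHat (k + 1) ξ T ≤ gapMajorant T₀ (e k) := fun k => by
    refine le_gapMajorant hT₀.le ((rhoHat_le _ _ hT.1.le).trans hT.2) ?_
    have h := mul_le_mul_of_nonneg_left (hn (k + 1)) (rhoHat_nonneg (k + 1) ξ hT.1.le)
    have h2 := rhoHat_mul_abs_le_two (k + 1) ξ T
    simp only [e]
    linarith
  have hg := summable_gapMajorant hT₀.le
  have hs : Summable fun k : ℕ => rhoHat (k + 1) ξ T :=
    .of_nonneg_of_le (fun k => rhoHat_nonneg _ _ hT.1.le) hbound (hg.comp_injective he)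
  exact ⟨hs, hs.tsum_le_tsum_of_inj e he (fun m _ => gapMajorant_nonneg hT₀.le m) hbound hg⟩
end

section
/- For all real numbers s, s′ with 1/2 < s < s′ ≤ 1, the double series ∑_{l=1}^∞ ∑_{k ≥ 1, k ≠ l} l^{2s′} / ( k^{2s} (k−l)² (k+l)² ) converges (is finite). -/
/-- The series `∑ k^{-a} (k - l)^{-2}` over pairs `(l, k)` of natural numbers converges for `a > 1`,
being a product of two convergent series in the variables `k` and `k - l`. -/
theorem summable_one_div_rpow_mul_one_div_sub_sq {a : ℝ} (ha : 1 < a) :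
    Summable (fun p : ℕ × ℕ =>
      1 / (p.2 : ℝ) ^ a * (1 / ((p.2 : ℝ) - (p.1 : ℝ)) ^ 2)) := by
  have h₁ : Summable (fun k : ℕ => 1 / (k : ℝ) ^ a) := Real.summable_one_div_nat_rpow.2 ha
  have h₂ : Summable (fun m : ℤ => 1 / (m : ℝ) ^ 2) :=
    Real.summable_one_div_int_pow.2 one_lt_two
  have h := h₁.mul_of_nonneg h₂ (fun k => by positivity) (fun m => by positivity)
  have hinj : Function.Injective (fun p : ℕ × ℕ => (p.2, (p.2 : ℤ) - (p.1 : ℤ))) := by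
    rintro ⟨l, k⟩ ⟨l', k'⟩ heq
    simp only [Prod.mk.injEq] at heq ⊢
    omega
  refine (h.comp_injective hinj).congr fun p => ?_
  simp

/-- For all `1/2 < s < s' ≤ 1`, the double series
`∑_{l ≥ 1} ∑_{k ≥ 1, k ≠ l} l^{2s'} / (k^{2s} (k−l)² (k+l)²)` converges.
Here `p = (l, k)` ranges over pairs of positive integers with `k ≠ l`. -/
theorem stmt8 (s s' : ℝ) (hs : 1 / 2 < s) (hss' : s < s') (hs' : s' ≤ 1) :
    Summable (fun p : ℕ × ℕ =>
      if 1 ≤ p.1 ∧ 1 ≤ p.2 ∧ p.2 ≠ p.1 then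
        (p.1 : ℝ) ^ (2 * s') /
          ((p.2 : ℝ) ^ (2 * s) * ((p.2 : ℝ) - (p.1 : ℝ)) ^ 2 * ((p.2 : ℝ) + (p.1 : ℝ)) ^ 2)
      else 0) := by
  refine Summable.of_nonneg_of_le (fun p => ?_) (fun p => ?_)
    (summable_one_div_rpow_mul_one_div_sub_sq (a := 2 * s) (by linarith))
  · split_ifs <;> positivity
  · split_ifs with h
    · obtain ⟨hl, -, -⟩ := h
      have hl' : (1 : ℝ) ≤ p.1 := by exact_mod_cast hl
      have hnum : (p.1 : ℝ) ^ (2 * s') ≤ ((p.2 : ℝ) + (p.1 : ℝ)) ^ 2 :=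
        calc (p.1 : ℝ) ^ (2 * s') ≤ (p.1 : ℝ) ^ (2 : ℝ) :=
              Real.rpow_le_rpow_of_exponent_le hl' (by linarith)
          _ = (p.1 : ℝ) ^ 2 := Real.rpow_two _
          _ ≤ ((p.2 : ℝ) + (p.1 : ℝ)) ^ 2 := by
              gcongr
              exact le_add_of_nonneg_left p.2.cast_nonneg
      rw [mul_comm _ (((p.2 : ℝ) + (p.1 : ℝ)) ^ 2), ← div_div, one_div_mul_one_div]
      gcongr
      exact div_le_one_of_le₀ hnum (by positivity)
    · positivity
end

section
/- For every real number s with 1/2 < s < 1 there exists a constant C > 0 such that for every integer k ≥ 1 one has ∑_{l ≥ 1, l ≠ k} k⁶ l^{2s} / ( (k−l)² (k+l)² ) ≤ C k^{4+2s}. -/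
/-- Since `l ≤ k + l` and `k ≤ k + l`, the weight `l ^ (2 * s)` is absorbed by `(k + l) ^ 2` at the
cost of the factor `k ^ (2 * s - 2)`. -/
lemma weighted_term_le {s k l d : ℝ} (hs : 0 ≤ s) (hs1 : s ≤ 1) (hk : 0 < k) (hl : 0 ≤ l) :
    k ^ 6 * l ^ (2 * s) / (d ^ 2 * (k + l) ^ 2) ≤ k ^ (4 + 2 * s) * (1 / d ^ 2) := by
  have hkl : 0 < k + l := by positivity
  have key : l ^ (2 * s) * k ^ (2 - 2 * s) ≤ (k + l) ^ 2 := by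
    calc l ^ (2 * s) * k ^ (2 - 2 * s)
        ≤ (k + l) ^ (2 * s) * (k + l) ^ (2 - 2 * s) := by
          gcongr <;> linarith
      _ = (k + l) ^ 2 := by
          rw [← Real.rpow_add hkl, ← Real.rpow_natCast]
          congr 1
          push_cast
          ring
  have hpow : k ^ 6 = k ^ (4 + 2 * s) * k ^ (2 - 2 * s) := by
    rw [← Real.rpow_add hk, ← Real.rpow_natCast]
    congr 1
    push_cast
    ring
  calc k ^ 6 * l ^ (2 * s) / (d ^ 2 * (k + l) ^ 2)
      = k ^ (4 + 2 * s) * (1 / d ^ 2) * (l ^ (2 * s) * k ^ (2 - 2 * s) / (k + l) ^ 2) := by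
        rw [hpow, ← div_div]
        ring
    _ ≤ k ^ (4 + 2 * s) * (1 / d ^ 2) * 1 := by
        gcongr
        exact (div_le_one (by positivity)).2 key
    _ = k ^ (4 + 2 * s) * (1 / d ^ 2) := mul_one _


/-- For every `1/2 < s < 1` there exists `C > 0` such that for every integer `k ≥ 1`,
`∑_{l ≥ 1, l ≠ k} k⁶ l^{2s} / ((k−l)² (k+l)²) ≤ C k^{4+2s}` (the series being convergent). -/
theorem stmt9 (s : ℝ) (hs : 1 / 2 < s) (hs1 : s < 1) :
    ∃ C > 0, ∀ k : ℕ, 1 ≤ k →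
      (Summable fun l : ℕ =>
        if 1 ≤ l ∧ l ≠ k then
          (k : ℝ) ^ 6 * (l : ℝ) ^ (2 * s) / (((k : ℝ) - (l : ℝ)) ^ 2 * ((k : ℝ) + (l : ℝ)) ^ 2)
        else 0) ∧
      (∑' l : ℕ,
          if 1 ≤ l ∧ l ≠ k then
            (k : ℝ) ^ 6 * (l : ℝ) ^ (2 * s) / (((k : ℝ) - (l : ℝ)) ^ 2 * ((k : ℝ) + (l : ℝ)) ^ 2)
          else 0)
        ≤ C * (k : ℝ) ^ (4 + 2 * s) := by
  have hsum : Summable fun n : ℤ => 1 / (n : ℝ) ^ 2 :=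
    Real.summable_one_div_int_pow.2 one_lt_two
  have hnonneg : ∀ n : ℤ, 0 ≤ 1 / (n : ℝ) ^ 2 := fun n => by positivity
  refine ⟨∑' n : ℤ, 1 / (n : ℝ) ^ 2,
    hsum.tsum_pos hnonneg 1 (by norm_num), fun k hk => ?_⟩
  have hk0 : (0 : ℝ) < k := by exact_mod_cast hk
  have hinj : Function.Injective fun l : ℕ => (k : ℤ) - l := fun a b hab => by
    simpa using hab
  have hle : ∀ l : ℕ,
      (if 1 ≤ l ∧ l ≠ k then
        (k : ℝ) ^ 6 * (l : ℝ) ^ (2 * s) / (((k : ℝ) - (l : ℝ)) ^ 2 * ((k : ℝ) + (l : ℝ)) ^ 2)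
      else 0) ≤ (k : ℝ) ^ (4 + 2 * s) * (1 / (((k : ℤ) - l : ℤ) : ℝ) ^ 2) := fun l => by
    split_ifs
    · push_cast
      exact weighted_term_le (by linarith) hs1.le hk0 (Nat.cast_nonneg l)
    · positivity
  have hmajor : Summable fun l : ℕ =>
      (k : ℝ) ^ (4 + 2 * s) * (1 / (((k : ℤ) - l : ℤ) : ℝ) ^ 2) :=
    (hsum.comp_injective hinj).mul_left _
  have hterm := Summable.of_nonneg_of_le (fun l => by split_ifs <;> positivity) hle hmajor
  refine ⟨hterm, (hterm.tsum_le_tsum hle hmajor).trans ?_⟩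
  rw [tsum_mul_left, mul_comm]
  gcongr
  exact tsum_comp_le_tsum_of_inj hsum hnonneg hinj
end

section
/- The improper integral ∫₀^∞ log( x² / √(x⁴ + 1) ) dx equals −π/√2. -/
open Real MeasureTheory

/-- An antiderivative of `x ↦ log (x² / √(x⁴ + 1))`, continuous on all of `ℝ`. -/
noncomputable def logRatioPrimitive (x : ℝ) : ℝ :=
  2 * (x * log x) - x * log (x ^ 4 + 1) / 2
    - (log (x ^ 2 + √2 * x + 1) - log (x ^ 2 - √2 * x + 1)) / (2 * √2)
    - (arctan (√2 * x + 1) + arctan (√2 * x - 1)) / √2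

lemma sq_add_sqrt_two_mul_add_one_pos (x : ℝ) : 0 < x ^ 2 + √2 * x + 1 := by
  nlinarith [sq_nonneg (x + √2 / 2), Real.sq_sqrt (zero_le_two (α := ℝ))]

lemma sq_sub_sqrt_two_mul_add_one_pos (x : ℝ) : 0 < x ^ 2 - √2 * x + 1 := by
  nlinarith [sq_nonneg (x - √2 / 2), Real.sq_sqrt (zero_le_two (α := ℝ))]

lemma log_sq_div_sqrt_pow_four_add_one {x : ℝ} (hx : 0 < x) :
    log (x ^ 2 / √(x ^ 4 + 1)) = 2 * log x - log (x ^ 4 + 1) / 2 := by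
  rw [log_div (by positivity) (by positivity), log_pow, log_sqrt (by positivity)]
  norm_num

lemma continuous_logRatioPrimitive : Continuous logRatioPrimitive := by
  unfold logRatioPrimitive
  have h₁ : Continuous fun x : ℝ => log (x ^ 4 + 1) :=
    Continuous.log (by fun_prop) fun x => by positivity
  have h₂ : Continuous fun x : ℝ => log (x ^ 2 + √2 * x + 1) :=
    Continuous.log (by fun_prop) fun x => (sq_add_sqrt_two_mul_add_one_pos x).ne'
  have h₃ : Continuous fun x : ℝ => log (x ^ 2 - √2 * x + 1) :=
    Continuous.log (by fun_prop) fun x => (sq_sub_sqrt_two_mul_add_one_pos x).ne'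
  have h₄ := continuous_mul_log
  have h₅ := continuous_arctan
  fun_prop

lemma logRatioPrimitive_zero : logRatioPrimitive 0 = 0 := by
  simp [logRatioPrimitive, arctan_neg]

lemma hasDerivAt_logRatioPrimitive {x : ℝ} (hx : 0 < x) :
    HasDerivAt logRatioPrimitive (log (x ^ 2 / √(x ^ 4 + 1))) x := by
  rw [log_sq_div_sqrt_pow_four_add_one hx]
  have hp := sq_add_sqrt_two_mul_add_one_pos x
  have hm := sq_sub_sqrt_two_mul_add_one_pos x
  have hq : 0 < x ^ 4 + 1 := by positivity
  have hs : √2 ^ 2 = (2 : ℝ) := Real.sq_sqrt zero_le_two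
  have hs0 : √2 ≠ (0 : ℝ) := by positivity
  have hid := hasDerivAt_id' x
  have hlin := hid.const_mul √2
  have h₀ := (hid.mul (hasDerivAt_log hx.ne')).const_mul 2
  have h₁ := (hid.mul (((hid.pow 4).add_const 1).log hq.ne')).div_const 2
  have h₂ := (((hid.pow 2).add hlin).add_const 1).log hp.ne'
  have h₃ := (((hid.pow 2).sub hlin).add_const 1).log hm.ne'
  have h₄ := (hlin.add_const 1).arctan
  have h₅ := (hlin.sub_const 1).arctan
  refine (((h₀.sub h₁).sub ((h₂.sub h₃).div_const (2 * √2))).sub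
    ((h₄.add h₅).div_const √2)).congr_deriv ?_
  have e₄ : 1 + (√2 * x + 1) ^ 2 = 2 * (x ^ 2 + √2 * x + 1) := by linear_combination x ^ 2 * hs
  have e₅ : 1 + (√2 * x - 1) ^ 2 = 2 * (x ^ 2 - √2 * x + 1) := by linear_combination x ^ 2 * hs
  have e₁ : x ^ 4 + 1 = (x ^ 2 + √2 * x + 1) * (x ^ 2 - √2 * x + 1) := by
    linear_combination x ^ 2 * hs
  have key : 2 - 2 * x ^ 4 / (x ^ 4 + 1)
      - ((2 * x + √2) / (x ^ 2 + √2 * x + 1) - (2 * x - √2) / (x ^ 2 - √2 * x + 1)) / (2 * √2)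
      - (√2 / (2 * (x ^ 2 + √2 * x + 1)) + √2 / (2 * (x ^ 2 - √2 * x + 1))) / √2 = 0 := by
    have : 2 - 2 * x ^ 4 / (x ^ 4 + 1)
        = 2 / ((x ^ 2 + √2 * x + 1) * (x ^ 2 - √2 * x + 1)) := by
      rw [← e₁]; field_simp; ring
    rw [this]
    generalize √2 = s at *
    have hp' := hp.ne'
    have hm' := hm.ne'
    field_simp
    grind
  simp only [e₄, e₅, Pi.add_apply, Pi.sub_apply, Pi.pow_apply]
  norm_num
  field_simp at key ⊢
  linear_combination key

lemma tendsto_mul_log_pow_four_sub_atTop :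
    Filter.Tendsto (fun x : ℝ => x * (log (x ^ 4 + 1) - 4 * log x)) Filter.atTop (nhds 0) := by
  have h : ∀ x : ℝ, 1 ≤ x → log (x ^ 4 + 1) - 4 * log x = log (1 + (x ^ 4)⁻¹) := fun x hx => by
    have hx0 : 0 < x := by linarith
    have : (4 : ℝ) * log x = log (x ^ 4) := by rw [log_pow]; norm_num
    rw [this, ← log_div (by positivity) (by positivity)]
    congr 1
    field_simp
  refine tendsto_of_tendsto_of_tendsto_of_le_of_le' tendsto_const_nhds tendsto_inv_atTop_zero ?_ ?_
  · filter_upwards [Filter.eventually_ge_atTop 1] with x hx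
    rw [h x hx]
    have : 0 ≤ (x ^ 4)⁻¹ := by positivity
    exact mul_nonneg (by linarith) (log_nonneg (by linarith))
  · filter_upwards [Filter.eventually_ge_atTop 1] with x hx
    rw [h x hx]
    have hx0 : 0 < x := by linarith
    have h₁ := log_le_sub_one_of_pos (show 0 < 1 + (x ^ 4)⁻¹ by positivity)
    calc x * log (1 + (x ^ 4)⁻¹) ≤ x * (x ^ 2)⁻¹ := by
          gcongr
          have : (x ^ 4)⁻¹ ≤ (x ^ 2)⁻¹ := inv_anti₀ (by positivity) (pow_le_pow_right₀ hx (by norm_num))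
          linarith
      _ = x⁻¹ := by field_simp

lemma tendsto_log_sub_log_atTop :
    Filter.Tendsto (fun x : ℝ => log (x ^ 2 + √2 * x + 1) - log (x ^ 2 - √2 * x + 1))
      Filter.atTop (nhds 0) := by
  have hlim : Filter.Tendsto (fun x : ℝ => 8 * √2 * x⁻¹) Filter.atTop (nhds 0) := by
    simpa using tendsto_inv_atTop_zero.const_mul (8 * √2)
  refine tendsto_of_tendsto_of_tendsto_of_le_of_le' tendsto_const_nhds hlim ?_ ?_
  · filter_upwards [Filter.eventually_ge_atTop 1] with x hx
    have : 0 ≤ √2 * x := by positivity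
    exact sub_nonneg.2 (log_le_log (sq_sub_sqrt_two_mul_add_one_pos x) (by linarith))
  · filter_upwards [Filter.eventually_ge_atTop 1] with x hx
    have hx0 : 0 < x := by linarith
    have hp := sq_add_sqrt_two_mul_add_one_pos x
    have hm := sq_sub_sqrt_two_mul_add_one_pos x
    rw [← log_div hp.ne' hm.ne']
    refine (log_le_sub_one_of_pos (div_pos hp hm)).trans ?_
    have hb : x ^ 2 / 4 ≤ x ^ 2 - √2 * x + 1 := by
      nlinarith [sq_nonneg (√2 * x - 1), sq_nonneg (√2 * x / 2 - 1),
        Real.sq_sqrt (zero_le_two (α := ℝ))]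
    calc (x ^ 2 + √2 * x + 1) / (x ^ 2 - √2 * x + 1) - 1
        = 2 * √2 * x / (x ^ 2 - √2 * x + 1) := by rw [div_sub_one hm.ne']; ring
      _ ≤ 2 * √2 * x / (x ^ 2 / 4) := by gcongr
      _ = 8 * √2 * x⁻¹ := by field_simp; norm_num

lemma tendsto_logRatioPrimitive_atTop :
    Filter.Tendsto logRatioPrimitive Filter.atTop (nhds (-(π / √2))) := by
  have hlin : Filter.Tendsto (fun x : ℝ => √2 * x) Filter.atTop Filter.atTop :=
    Filter.tendsto_id.const_mul_atTop (by positivity)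
  have harctan := tendsto_arctan_atTop.mono_right nhdsWithin_le_nhds
  have h₁ := harctan.comp (Filter.tendsto_atTop_add_const_right _ 1 hlin)
  have h₂ := harctan.comp (Filter.tendsto_atTop_add_const_right _ (-1) hlin)
  have h := ((tendsto_mul_log_pow_four_sub_atTop.const_mul (-1 / 2)).sub
    (tendsto_log_sub_log_atTop.div_const (2 * √2))).sub ((h₁.add h₂).div_const √2)
  convert h using 2
  · simp only [logRatioPrimitive, Function.comp_apply, ← sub_eq_add_neg]
    ring
  · ring

/-- The improper integral `∫₀^∞ log(x² / √(x⁴ + 1)) dx` converges absolutely and equals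
`−π/√2`. -/
theorem stmt10 :
    IntegrableOn (fun x : ℝ => Real.log (x ^ 2 / Real.sqrt (x ^ 4 + 1))) (Set.Ioi 0) ∧
    ∫ x in Set.Ioi (0:ℝ), Real.log (x ^ 2 / Real.sqrt (x ^ 4 + 1)) =
      -(Real.pi / Real.sqrt 2) := by
  have hcont := continuous_logRatioPrimitive.continuousWithinAt (s := Set.Ici 0) (x := 0)
  have hderiv : ∀ x ∈ Set.Ioi (0 : ℝ),
      HasDerivAt logRatioPrimitive (log (x ^ 2 / √(x ^ 4 + 1))) x :=
    fun x hx => hasDerivAt_logRatioPrimitive hx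
  have hneg : ∀ x ∈ Set.Ioi (0 : ℝ), log (x ^ 2 / √(x ^ 4 + 1)) ≤ 0 := fun x _ =>
    log_nonpos (by positivity)
      (div_le_one_of_le₀ (le_sqrt_of_sq_le (by nlinarith)) (sqrt_nonneg _))
  refine ⟨integrableOn_Ioi_deriv_of_nonpos hcont hderiv hneg tendsto_logRatioPrimitive_atTop, ?_⟩
  rw [integral_Ioi_of_hasDerivAt_of_nonpos hcont hderiv hneg tendsto_logRatioPrimitive_atTop,
    logRatioPrimitive_zero, sub_zero]
end

section
/- There exists a constant C > 0 such that for every ε ∈ (0, 1/2) one has ∑_{k=2}^∞ log( ε π² (k²−1) / √( (ε π² (k²−1))² + 1/(4ε²) ) ) ≤ −1/(2ε) + C · log(1/ε). -/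
open Real

/-- The summand `log( επ²(k²−1) / √((επ²(k²−1))² + 1/(4ε²)) )`. -/
noncomputable def s11term (ε : ℝ) (k : ℕ) : ℝ :=
  Real.log (ε * Real.pi ^ 2 * ((k : ℝ) ^ 2 - 1) /
    Real.sqrt ((ε * Real.pi ^ 2 * ((k : ℝ) ^ 2 - 1)) ^ 2 + 1 / (4 * ε ^ 2)))

lemma s11term_eq {ε : ℝ} (hε : 0 < ε) {k : ℕ} (hk : 2 ≤ k) :
    s11term ε k =
      -(1 / 2 * Real.log (1 + (1 / (2 * ε ^ 2 * π ^ 2)) ^ 2 / ((k : ℝ) ^ 2 - 1) ^ 2)) := by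
  have hk' : (2 : ℝ) ≤ k := by exact_mod_cast hk
  have hd : 0 < (k : ℝ) ^ 2 - 1 := by nlinarith
  have hπ := Real.pi_pos
  have ha : 0 < ε * π ^ 2 * ((k : ℝ) ^ 2 - 1) := by positivity
  have hs : 0 < (ε * π ^ 2 * ((k : ℝ) ^ 2 - 1)) ^ 2 + 1 / (4 * ε ^ 2) := by positivity
  have h : 1 + (1 / (2 * ε ^ 2 * π ^ 2)) ^ 2 / ((k : ℝ) ^ 2 - 1) ^ 2 =
      ((ε * π ^ 2 * ((k : ℝ) ^ 2 - 1)) ^ 2 + 1 / (4 * ε ^ 2)) /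
        (ε * π ^ 2 * ((k : ℝ) ^ 2 - 1)) ^ 2 := by
    have := hd.ne'
    field_simp
    ring
  rw [s11term, h, Real.log_div ha.ne' (Real.sqrt_pos.2 hs).ne', Real.log_sqrt hs.le,
    Real.log_div hs.ne' (by positivity), Real.log_pow]
  push_cast
  ring

lemma s11term_le {ε : ℝ} (hε : 0 < ε) {k : ℕ} (hk : 2 ≤ k) :
    s11term ε k ≤
      -(1 / 2 * Real.log (1 + (1 / (2 * ε ^ 2 * π ^ 2)) ^ 2 / (k : ℝ) ^ 4)) := by
  have hk' : (2 : ℝ) ≤ k := by exact_mod_cast hk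
  have hd : 0 < (k : ℝ) ^ 2 - 1 := by nlinarith
  have hle : ((k : ℝ) ^ 2 - 1) ^ 2 ≤ (k : ℝ) ^ 4 := by nlinarith
  rw [s11term_eq hε hk]
  gcongr

lemma summable_s11term {ε : ℝ} (hε : 0 < ε) : Summable fun k : ℕ => s11term ε (k + 2) := by
  rw [← summable_neg_iff]
  have hs : Summable fun k : ℕ =>
      1 / 2 * (1 / (2 * ε ^ 2 * π ^ 2)) ^ 2 * (1 / ((k + 1 : ℕ) : ℝ) ^ 4) :=
    ((summable_nat_add_iff 1).2 (Real.summable_one_div_nat_pow.2 (by norm_num : 1 < 4))).mul_left _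
  refine Summable.of_nonneg_of_le (fun k => ?_) (fun k => ?_) hs
  · rw [s11term_eq hε (by omega), neg_neg]
    have : 0 ≤ Real.log (1 + (1 / (2 * ε ^ 2 * π ^ 2)) ^ 2 / (((k + 2 : ℕ) : ℝ) ^ 2 - 1) ^ 2) :=
      Real.log_nonneg (by linarith [show 0 ≤ (1 / (2 * ε ^ 2 * π ^ 2)) ^ 2 /
        (((k + 2 : ℕ) : ℝ) ^ 2 - 1) ^ 2 by positivity])
    positivity
  · rw [s11term_eq hε (by omega), neg_neg]
    have hle : ((k + 1 : ℕ) : ℝ) ^ 4 ≤ (((k + 2 : ℕ) : ℝ) ^ 2 - 1) ^ 2 := by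
      have hk : (0 : ℝ) ≤ k := k.cast_nonneg
      have : ((k + 1 : ℕ) : ℝ) ^ 2 ≤ ((k + 2 : ℕ) : ℝ) ^ 2 - 1 := by push_cast; nlinarith
      calc ((k + 1 : ℕ) : ℝ) ^ 4 = (((k + 1 : ℕ) : ℝ) ^ 2) ^ 2 := by ring
        _ ≤ _ := by gcongr
    have hd : (0 : ℝ) < ((k + 1 : ℕ) : ℝ) ^ 4 := by positivity
    have hpos : 0 < 1 + (1 / (2 * ε ^ 2 * π ^ 2)) ^ 2 / (((k + 2 : ℕ) : ℝ) ^ 2 - 1) ^ 2 := by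
      positivity
    have hlog := Real.log_le_sub_one_of_pos hpos
    rw [add_sub_cancel_left] at hlog
    calc _ ≤ 1 / 2 * ((1 / (2 * ε ^ 2 * π ^ 2)) ^ 2 / ((k + 1 : ℕ) : ℝ) ^ 4) :=
          mul_le_mul_of_nonneg_left (hlog.trans (by gcongr)) (by norm_num)
      _ = _ := by ring

lemma log_norm_one_sub_mul_I (t : ℝ) :
    Real.log ‖1 - (t : ℂ) * Complex.I‖ = 1 / 2 * Real.log (1 + t ^ 2) := by
  have h : ‖1 - (t : ℂ) * Complex.I‖ = √(1 + t ^ 2) := by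
    rw [Complex.norm_eq_sqrt_sq_add_sq]
    simp
  rw [h, Real.log_sqrt (by positivity)]
  ring

lemma sinh_abs_im_le_norm_sin (z : ℂ) : Real.sinh |z.im| ≤ ‖Complex.sin z‖ := by
  refine abs_le_of_sq_le_sq' ?_ (norm_nonneg _) |>.2
  rw [← Complex.normSq_eq_norm_sq, Complex.normSq_apply, Complex.sin_eq]
  have h : Real.sinh |z.im| ^ 2 = Real.sinh z.im ^ 2 := by
    rw [← Real.abs_sinh, sq_abs]
  rw [h]
  simp only [← Complex.ofReal_sin, ← Complex.ofReal_cos, ← Complex.ofReal_sinh,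
    ← Complex.ofReal_cosh, ← Complex.ofReal_mul, Complex.add_re, Complex.add_im,
    Complex.ofReal_re, Complex.ofReal_im, Complex.re_ofReal_mul, Complex.im_ofReal_mul,
    Complex.I_re, Complex.I_im]
  nlinarith [Real.cosh_sq z.im, Real.sin_sq_add_cos_sq z.re, sq_nonneg (Real.sin z.re)]

lemma exp_div_four_le_sinh {x : ℝ} (hx : 1 ≤ x) : Real.exp x / 4 ≤ Real.sinh x := by
  have h1 : Real.exp (-x) ≤ 1 := Real.exp_le_one_iff.2 (by linarith)
  have h2 := Real.add_one_le_exp x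
  rw [Real.sinh_eq]
  linarith

/-- Logarithmic form of Euler's product for the sine, evaluated on the diagonal. -/
lemma tendsto_sum_log_one_add {x : ℝ} (hx : 0 < x) :
    Filter.Tendsto
      (fun n : ℕ => ∑ j ∈ Finset.range n,
        1 / 2 * Real.log (1 + (2 * x ^ 2 / π ^ 2) ^ 2 / ((j + 1 : ℕ) : ℝ) ^ 4))
      Filter.atTop
      (nhds (Real.log ‖Complex.sin (x * (1 + Complex.I))‖ - Real.log (√2 * x))) := by
  set z : ℂ := x * (1 + Complex.I) / π with hz
  have hπ : (π : ℂ) ≠ 0 := Complex.ofReal_ne_zero.2 Real.pi_ne_zero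
  have hπz : (π : ℂ) * z = x * (1 + Complex.I) := by rw [hz]; field_simp
  have hnorm : ‖(x : ℂ) * (1 + Complex.I)‖ = √2 * x := by
    have : ‖1 + Complex.I‖ = √2 := by
      rw [Complex.norm_eq_sqrt_sq_add_sq]; simp; norm_num
    rw [norm_mul, this, Complex.norm_real, Real.norm_of_nonneg hx.le, mul_comm]
  have hfac (j : ℕ) : 1 - z ^ 2 / ((j : ℂ) + 1) ^ 2 =
      1 - ((2 * x ^ 2 / π ^ 2 / ((j + 1 : ℕ) : ℝ) ^ 2 : ℝ) : ℂ) * Complex.I := by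
    have hI : (1 + Complex.I) ^ 2 = 2 * Complex.I := by
      linear_combination Complex.I_sq
    rw [hz, div_pow, mul_pow, hI]
    push_cast
    ring
  have hlog (j : ℕ) : Real.log ‖1 - z ^ 2 / ((j : ℂ) + 1) ^ 2‖ =
      1 / 2 * Real.log (1 + (2 * x ^ 2 / π ^ 2) ^ 2 / ((j + 1 : ℕ) : ℝ) ^ 4) := by
    rw [hfac, log_norm_one_sub_mul_I, div_pow _ (((j + 1 : ℕ) : ℝ) ^ 2), ← pow_mul]
  have hne (j : ℕ) : ‖1 - z ^ 2 / ((j : ℂ) + 1) ^ 2‖ ≠ 0 := by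
    rw [hfac, norm_ne_zero_iff]
    intro h
    have hre := congrArg Complex.re h
    rw [Complex.sub_re, Complex.re_ofReal_mul] at hre
    simp at hre
  have hsin : ‖Complex.sin (x * (1 + Complex.I))‖ ≠ 0 := by
    have h := sinh_abs_im_le_norm_sin (x * (1 + Complex.I))
    have him : ((x : ℂ) * (1 + Complex.I)).im = x := by simp
    rw [him, abs_of_pos hx] at h
    exact ((Real.sinh_pos_iff.2 hx).trans_le h).ne'
  have hlim := ((Complex.tendsto_euler_sin_prod z).norm.log (by rwa [hπz])).sub_const
    (Real.log (√2 * x))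
  rw [hπz] at hlim
  refine hlim.congr fun n => ?_
  rw [norm_mul, hnorm, norm_prod, Real.log_mul (by positivity)
    (Finset.prod_ne_zero_iff.2 fun j _ => hne j), Real.log_prod (fun j _ => hne j),
    add_sub_cancel_left]
  exact Finset.sum_congr rfl fun j _ => hlog j

/-- There is `C > 0` such that for every `ε ∈ (0, 1/2)`,
`∑_{k=2}^∞ log( επ²(k²−1) / √((επ²(k²−1))² + 1/(4ε²)) ) ≤ −1/(2ε) + C log(1/ε)`
(the series being absolutely convergent). -/
theorem stmt11 :
    ∃ C > 0, ∀ ε : ℝ, 0 < ε → ε < 1 / 2 →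
      (Summable fun k : ℕ => s11term ε (k + 2)) ∧
      (∑' k : ℕ, s11term ε (k + 2)) ≤ -1 / (2 * ε) + C * Real.log (1 / ε) := by
  refine ⟨3, by norm_num, fun ε hε hε2 => ⟨summable_s11term hε, ?_⟩⟩
  obtain ⟨x, hx⟩ : ∃ x, x = 1 / (2 * ε) := ⟨_, rfl⟩
  have hx1 : 1 ≤ x := by rw [hx, le_div_iff₀ (by positivity)]; linarith
  have hx0 : 0 < x := by linarith
  have hM : 1 / (2 * ε ^ 2 * π ^ 2) = 2 * x ^ 2 / π ^ 2 := by
    rw [hx]; field_simp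
  set f : ℕ → ℝ := fun j =>
    1 / 2 * Real.log (1 + (2 * x ^ 2 / π ^ 2) ^ 2 / ((j + 1 : ℕ) : ℝ) ^ 4) with hf
  have hlim := (Filter.tendsto_add_atTop_iff_nat 1).2 (tendsto_sum_log_one_add hx0)
  have hbound := le_of_tendsto_of_tendsto'
    (summable_s11term hε).hasSum.tendsto_sum_nat (hlim.const_sub (f 0)) fun n => by
      rw [Finset.sum_range_succ']
      calc ∑ k ∈ Finset.range n, s11term ε (k + 2)
          ≤ ∑ k ∈ Finset.range n, -f (k + 1) := by
            refine Finset.sum_le_sum fun k _ => ?_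
            have h := s11term_le hε (k := k + 2) (by omega)
            rwa [hM] at h
        _ = _ := by rw [Finset.sum_neg_distrib]; simp only [hf]; ring
  have hsin : x - Real.log 4 ≤ Real.log ‖Complex.sin (x * (1 + Complex.I))‖ := by
    have h := sinh_abs_im_le_norm_sin (x * (1 + Complex.I))
    have him : ((x : ℂ) * (1 + Complex.I)).im = x := by simp
    rw [him, abs_of_pos hx0] at h
    rw [← Real.log_exp x, ← Real.log_div (Real.exp_pos _).ne' (by norm_num), Real.log_exp]
    exact Real.log_le_log (by positivity) ((exp_div_four_le_sinh hx1).trans h)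
  have hf0 : f 0 ≤ 1 / 2 * Real.log (2 * x ^ 4) := by
    have hle : 2 * x ^ 2 / π ^ 2 ≤ x ^ 2 := by
      rw [div_le_iff₀ (by positivity)]
      have hπ : 2 ≤ π ^ 2 := by nlinarith [Real.pi_gt_three]
      nlinarith [mul_le_mul_of_nonneg_left hπ (sq_nonneg x)]
    have hsq : (2 * x ^ 2 / π ^ 2) ^ 2 ≤ x ^ 4 := by
      calc (2 * x ^ 2 / π ^ 2) ^ 2 ≤ (x ^ 2) ^ 2 := by gcongr
        _ = x ^ 4 := by ring
    have h1 : 1 ≤ x ^ 4 := one_le_pow₀ hx1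
    simp only [hf, zero_add, Nat.cast_one, one_pow, div_one]
    gcongr
    linarith
  have hε' : Real.log (1 / ε) = Real.log 2 + Real.log x := by
    rw [← Real.log_mul (by norm_num) hx0.ne', hx]; congr 1; field_simp
  have h4 : Real.log 4 = 2 * Real.log 2 := by
    rw [show (4 : ℝ) = 2 ^ 2 by norm_num, Real.log_pow]; norm_num
  rw [Real.log_mul (by norm_num) (by positivity), Real.log_pow] at hf0
  rw [Real.log_mul (by positivity) hx0.ne', Real.log_sqrt (by norm_num)] at hbound
  rw [hε', show -1 / (2 * ε) = -x by rw [hx]; ring]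
  push_cast at hf0
  linarith
end

section
/- There exists a constant β ≥ 1 such that for every integer k ≥ 1 and every complex number z one has ∏_{n ≥ 1, n ≠ k} |1 − z/(ω_n − ω_k)| + ∏_{n ≥ 1, n ≠ k} |1 + z/(ω_n + ω_k)| ≤ β e^{β |z|^{1/2}}, where both infinite products converge. -/
open Real

/-- The frequencies `ω_n = π²(n² − 1) = λ_n − λ₁`, where `λ_n = π²n²` are the Dirichlet
eigenvalues of `-d²/dx²` on `(0,1)`. -/
noncomputable def om (n : ℕ) : ℝ := Real.pi ^ 2 * ((n : ℝ) ^ 2 - 1)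

lemma Real.sinh_le_mul_exp (x : ℝ) : Real.sinh x ≤ x * Real.exp x := by
  have h : (1 - 2 * x) * Real.exp x ≤ Real.exp (-x) := by
    have h1 : 1 - 2 * x ≤ Real.exp (-(2 * x)) := by
      have := Real.add_one_le_exp (-(2 * x))
      linarith
    have h2 : Real.exp (-x) = Real.exp (-(2 * x)) * Real.exp x := by
      rw [← Real.exp_add]
      ring_nf
    rw [h2]
    gcongr
  rw [Real.sinh_eq]
  linarith

/-- The partial products of the Weierstrass product of `sinh (π t) / (π t)` are at most
`exp (π t)`. -/
lemma prod_range_one_add_sq_div_le (M : ℕ) {t : ℝ} (ht : 0 ≤ t) :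
    ∏ j ∈ Finset.range M, (1 + t ^ 2 / ((j : ℝ) + 1) ^ 2) ≤ Real.exp (π * t) := by
  rcases ht.eq_or_lt with rfl | ht
  · simp
  have hpos : 0 < π * t := by positivity
  have hlim : Filter.Tendsto
      (fun n : ℕ => π * t * ∏ j ∈ Finset.range n, (1 + t ^ 2 / ((j : ℝ) + 1) ^ 2))
      Filter.atTop (nhds (Real.sinh (π * t))) := by
    have h := (Complex.tendsto_euler_sin_prod (t * Complex.I)).mul_const (-Complex.I)
    rw [← mul_assoc, Complex.sin_mul_I] at h
    have h' := (Complex.continuous_re.tendsto _).comp h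
    refine (h'.congr fun n => ?_).trans_eq ?_
    · have : (π * t * Complex.I * ∏ j ∈ Finset.range n,
          (1 - (t * Complex.I) ^ 2 / ((j : ℂ) + 1) ^ 2)) * (-Complex.I) =
          ((π * t * ∏ j ∈ Finset.range n, (1 + t ^ 2 / ((j : ℝ) + 1) ^ 2) : ℝ) : ℂ) := by
        push_cast
        simp only [mul_pow, Complex.I_sq, mul_neg, mul_one, neg_div, sub_neg_eq_add]
        linear_combination (-(π * t * ∏ j ∈ Finset.range n,
          (1 + (t : ℂ) ^ 2 / ((j : ℂ) + 1) ^ 2))) * Complex.I_sq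
      simp only [Function.comp_apply, this, Complex.ofReal_re]
    · have : Complex.sinh (π * t) * Complex.I * (-Complex.I) =
          ((Real.sinh (π * t) : ℝ) : ℂ) := by
        push_cast
        linear_combination (-Complex.sinh (π * t)) * Complex.I_sq
      rw [this, Complex.ofReal_re]
  have hmono : Monotone
      (fun n : ℕ => π * t * ∏ j ∈ Finset.range n, (1 + t ^ 2 / ((j : ℝ) + 1) ^ 2)) := by
    refine monotone_nat_of_le_succ fun n => ?_
    rw [Finset.prod_range_succ]
    refine mul_le_mul_of_nonneg_left (le_mul_of_one_le_right ?_ ?_) hpos.le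
    · exact Finset.prod_nonneg fun j _ => by positivity
    · exact le_add_of_nonneg_right (by positivity)
  exact le_of_mul_le_mul_left
    ((hmono.ge_of_tendsto hlim M).trans (Real.sinh_le_mul_exp _)) hpos

/-- A product whose factors deviate from `1` by at most `t² / (n - k)²` converges, and is bounded
uniformly in `k`. -/
lemma multipliable_and_tprod_norm_one_add_le {g : ℕ → ℂ} {t : ℝ} (ht : 0 ≤ t) (k : ℕ)
    (hg : ∀ n, ‖g n‖ ≤ t ^ 2 / ((n : ℝ) - k) ^ 2) :
    Multipliable (fun n => ‖1 + g n‖) ∧ ∏' n, ‖1 + g n‖ ≤ Real.exp (2 * π * t) := by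
  have hle : ∀ n, ‖1 + g n‖ ≤ 1 + t ^ 2 / ((n : ℝ) - k) ^ 2 := fun n =>
    (norm_add_le _ _).trans (by simpa using hg n)
  have hsum : Summable fun n => ‖g n‖ := by
    refine Summable.of_nonneg_of_le (fun n => norm_nonneg _) hg ?_
    rw [← summable_nat_add_iff k]
    simpa [div_eq_mul_inv] using
      (Real.summable_nat_pow_inv.mpr one_lt_two).mul_left (t ^ 2)
  have hmul : Multipliable fun n => ‖1 + g n‖ := (multipliable_one_add_of_summable hsum).norm
  refine ⟨hmul, ?_⟩
  have hlim := (Filter.tendsto_add_atTop_iff_nat (k + 1)).mpr hmul.hasProd.tendsto_prod_nat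
  refine le_of_tendsto' hlim fun M => ?_
  rw [add_comm M, Finset.prod_range_add, Finset.prod_range_succ, ← Finset.prod_range_reflect]
  have hk : ‖1 + g k‖ ≤ 1 := by simpa using hle k
  have hleft : ∏ j ∈ Finset.range k, ‖1 + g (k - 1 - j)‖ ≤ Real.exp (π * t) := by
    refine le_trans (Finset.prod_le_prod (fun _ _ => norm_nonneg _) fun j hj => ?_)
      (prod_range_one_add_sq_div_le k ht)
    refine (hle _).trans_eq ?_
    have : ((k - 1 - j : ℕ) : ℝ) = k - 1 - j := by
      have := Finset.mem_range.mp hj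
      rw [Nat.sub_sub, Nat.cast_sub (by omega)]
      push_cast
      ring
    rw [this]
    ring
  have hright : ∏ j ∈ Finset.range M, ‖1 + g (k + 1 + j)‖ ≤ Real.exp (π * t) := by
    refine le_trans (Finset.prod_le_prod (fun _ _ => norm_nonneg _) fun j hj => ?_)
      (prod_range_one_add_sq_div_le M ht)
    refine (hle _).trans_eq ?_
    push_cast
    ring
  calc _ ≤ Real.exp (π * t) * 1 * Real.exp (π * t) := by gcongr
    _ = Real.exp (2 * π * t) := by
      rw [mul_one, ← Real.exp_add]
      ring_nf

/-- If `|c n| ≥ π² (n - k)²` for `n ≥ 1`, the product of `|1 + z / c n|` over `n ≥ 1`, `n ≠ k`,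
converges and is at most `exp (2 |z|^{1/2})`. -/
lemma multipliable_and_tprod_norm_one_add_div_le {c : ℕ → ℝ} (k : ℕ)
    (hc : ∀ n : ℕ, 1 ≤ n → π ^ 2 * ((n : ℝ) - k) ^ 2 ≤ |c n|) (z : ℂ) :
    (Multipliable fun n : ℕ => if 1 ≤ n ∧ n ≠ k then ‖1 + z / (c n : ℂ)‖ else 1) ∧
      (∏' n : ℕ, if 1 ≤ n ∧ n ≠ k then ‖1 + z / (c n : ℂ)‖ else 1)
        ≤ Real.exp (2 * ‖z‖ ^ ((1 : ℝ) / 2)) := by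
  have hfun : (fun n : ℕ => if 1 ≤ n ∧ n ≠ k then ‖1 + z / (c n : ℂ)‖ else 1) =
      fun n : ℕ => ‖1 + if 1 ≤ n ∧ n ≠ k then z / (c n : ℂ) else 0‖ := by
    ext n
    split_ifs <;> simp
  have ht : 0 ≤ √‖z‖ / π := by positivity
  have key := multipliable_and_tprod_norm_one_add_le
    (g := fun n : ℕ => if 1 ≤ n ∧ n ≠ k then z / (c n : ℂ) else 0) ht k fun n => by
      split_ifs with hn
      · have hnk : (n : ℝ) - k ≠ 0 := sub_ne_zero.mpr (Nat.cast_injective.ne hn.2)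
        rw [div_pow, Real.sq_sqrt (norm_nonneg z), div_div, norm_div, Complex.norm_real,
          Real.norm_eq_abs]
        have := hc n hn.1
        gcongr
      · rw [norm_zero]
        positivity
  have he : 2 * π * (√‖z‖ / π) = 2 * ‖z‖ ^ ((1 : ℝ) / 2) := by
    rw [← Real.sqrt_eq_rpow]
    field_simp
  rw [he] at key
  rw [hfun]
  exact key

lemma le_abs_om_sub_om (n k : ℕ) : π ^ 2 * ((n : ℝ) - k) ^ 2 ≤ |om n - om k| := by
  have h : om n - om k = π ^ 2 * (((n : ℝ) - k) * (n + k)) := by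
    unfold om
    ring
  rw [h, abs_mul, abs_of_nonneg (sq_nonneg π), abs_mul, ← sq_abs ((n : ℝ) - k),
    sq |(n : ℝ) - k|, abs_of_nonneg (by positivity : (0 : ℝ) ≤ n + k)]
  gcongr
  rw [abs_le]
  constructor <;> linarith [Nat.cast_nonneg (α := ℝ) n, Nat.cast_nonneg (α := ℝ) k]

lemma le_abs_om_add_om {n k : ℕ} (hn : 1 ≤ n) (hk : 1 ≤ k) :
    π ^ 2 * ((n : ℝ) - k) ^ 2 ≤ |om n + om k| := by
  have h : om n + om k = π ^ 2 * ((n : ℝ) ^ 2 + (k : ℝ) ^ 2 - 2) := by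
    unfold om
    ring
  refine le_trans ?_ (le_abs_self _)
  rw [h]
  gcongr
  have hnk : (1 : ℝ) ≤ n * k := by exact_mod_cast Nat.mul_pos hn hk
  linarith [sub_sq (n : ℝ) k]

/-- There is `β ≥ 1` such that for every integer `k ≥ 1` and every `z ∈ ℂ`, the products
`∏_{n ≥ 1, n ≠ k} |1 − z/(ω_n − ω_k)|` and `∏_{n ≥ 1, n ≠ k} |1 + z/(ω_n + ω_k)|` converge
and their sum is at most `β e^{β|z|^{1/2}}`. -/
theorem stmt13 :
    ∃ β : ℝ, 1 ≤ β ∧ ∀ k : ℕ, 1 ≤ k → ∀ z : ℂ,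
      (Multipliable fun n : ℕ =>
        if 1 ≤ n ∧ n ≠ k then ‖1 - z / ((om n - om k : ℝ) : ℂ)‖ else 1) ∧
      (Multipliable fun n : ℕ =>
        if 1 ≤ n ∧ n ≠ k then ‖1 + z / ((om n + om k : ℝ) : ℂ)‖ else 1) ∧
      (∏' n : ℕ, if 1 ≤ n ∧ n ≠ k then ‖1 - z / ((om n - om k : ℝ) : ℂ)‖ else 1)
          + (∏' n : ℕ, if 1 ≤ n ∧ n ≠ k then ‖1 + z / ((om n + om k : ℝ) : ℂ)‖ else 1)
        ≤ β * Real.exp (β * ‖z‖ ^ ((1 : ℝ) / 2)) := by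
  refine ⟨2, one_le_two, fun k hk z => ?_⟩
  obtain ⟨hm₁, hb₁⟩ := multipliable_and_tprod_norm_one_add_div_le (c := fun n => om n - om k) k
    (fun n _ => le_abs_om_sub_om n k) (-z)
  obtain ⟨hm₂, hb₂⟩ := multipliable_and_tprod_norm_one_add_div_le (c := fun n => om n + om k) k
    (fun n hn => le_abs_om_add_om hn hk) z
  simp only [neg_div, ← sub_eq_add_neg, norm_neg] at hm₁ hb₁
  exact ⟨hm₁, hm₂, by linarith⟩
end
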